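/- (Theorem 5.2: generalized σ-form of the Painlevé IV equation.) For every integer n ≥ 1 and every t ∈ U with R_{n,j}(t) ≠ 0 for all 1 ≤ j ≤ N: σ_n(t) = Σ_{j=1}^N t_j·∂_jσ_n(t) − (1/2)·Σ_{j=1}^N sgn(R_{n,j}(t) + R_{n−1,j}(t))·√(Δ_j(t)), where Δ_j(t) = (∂_j²σ_n + Σ_{k≠j} ∂_k∂_jσ_n)²(t) + 4·(2n + δσ_n(t))·∂_jσ_n(t)·(∂_jσ_n(t) − 2γ_j) is nonnegative and sgn(u) = 1 for u > 0, −1 for u < 0 and 0 for u = 0. -/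

import Mathlib

open MeasureTheory Polynomial

noncomputable def pd {N : ℕ} (j : Fin N) (f : (Fin N → ℝ) → ℝ) (x : Fin N → ℝ) : ℝ :=
  deriv (fun s => f (Function.update x j s)) (x j)

theorem integrable_eval_mul_exp_neg_sq (D : ℝ[X]) :
    Integrable fun y : ℝ => D.eval y * Real.exp (-y ^ 2) := by
  induction D using Polynomial.induction_on' with
  | add p q hp hq => exact (hp.add hq).congr (.of_forall fun y => by simp [add_mul])
  | monomial k c =>
    have h := (integrable_rpow_mul_exp_neg_mul_sq one_pos
      (s := k) (by linarith [k.cast_nonneg (α := ℝ)])).const_mul c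
    simpa [mul_assoc] using h

theorem integrable_of_le_eval_mul_exp_neg_sq {g : ℝ → ℝ} (hg : Continuous g) {D : ℝ[X]}
    (hD : ∀ y, |g y| ≤ D.eval y * Real.exp (-y ^ 2)) : Integrable g :=
  (integrable_eval_mul_exp_neg_sq D).mono' hg.aestronglyMeasurable (.of_forall hD)

theorem abs_rpow_le_one_add_sq_pow (s u : ℝ) (hu : 0 ≤ s ∨ 1 ≤ |u|) :
    |u| ^ s ≤ (1 + u ^ 2) ^ ⌈|s|⌉₊ := by
  have h1 : |u| ≤ 1 + u ^ 2 := by nlinarith [sq_abs u, sq_nonneg (|u| - 1)]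
  have h2 : (1 : ℝ) ≤ 1 + u ^ 2 := by nlinarith
  rw [← Real.rpow_natCast]
  rcases hu with hs | hu
  · calc |u| ^ s ≤ (1 + u ^ 2) ^ s := Real.rpow_le_rpow (abs_nonneg u) h1 hs
      _ ≤ _ := Real.rpow_le_rpow_of_exponent_le h2 ((le_abs_self s).trans (Nat.le_ceil _))
  · calc |u| ^ s ≤ |u| ^ (⌈|s|⌉₊ : ℝ) :=
          Real.rpow_le_rpow_of_exponent_le hu ((le_abs_self s).trans (Nat.le_ceil _))
      _ ≤ _ := Real.rpow_le_rpow (abs_nonneg u) h1 (Nat.cast_nonneg _)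

theorem locallyIntegrable_abs_sub_rpow {s : ℝ} (hs : -1 < s) (a : ℝ) :
    LocallyIntegrable fun y : ℝ => |y - a| ^ s := by
  have h0 : LocallyIntegrable fun y : ℝ => |y| ^ s := by
    refine locallyIntegrable_of_norm_le_rpow (C := 1) (α := -s) (by simp) (by simp; linarith)
      (.of_forall fun y => ?_) (by fun_prop : Measurable fun y : ℝ => |y| ^ s).aestronglyMeasurable
    simp [abs_of_nonneg (Real.rpow_nonneg (abs_nonneg y) s)]
  rw [locallyIntegrable_iff] at h0 ⊢
  intro K hK
  have := (measurePreserving_sub_right volume a).integrableOn_comp_preimage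
    (f := fun y : ℝ => |y| ^ s) (s := (fun y => y - a) '' K)
    (Homeomorph.subRight a).measurableEmbedding
  rw [Set.preimage_image_eq _ (sub_left_injective)] at this
  exact this.2 (h0 _ (hK.image (by fun_prop)))

theorem integrable_abs_sub_rpow_mul {s : ℝ} (hs : -1 < s) (a : ℝ) {g : ℝ → ℝ} (hg : Continuous g)
    {D : ℝ[X]} (hD : ∀ y, |g y| ≤ D.eval y * Real.exp (-y ^ 2)) :
    Integrable fun y : ℝ => |y - a| ^ s * g y := by
  rw [← integrableOn_univ, ← Set.union_compl_self (Set.Icc (a - 1) (a + 1))]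
  refine IntegrableOn.union ?_ ?_
  · exact ((locallyIntegrable_abs_sub_rpow hs a).integrableOn_isCompact isCompact_Icc).mul_continuousOn
      hg.continuousOn isCompact_Icc
  · refine Integrable.mono'
      (integrable_eval_mul_exp_neg_sq ((1 + (X - C a) ^ 2) ^ ⌈|s|⌉₊ * D)).integrableOn
      (Measurable.aestronglyMeasurable (by have := hg.measurable; fun_prop)) ?_
    refine (ae_restrict_iff' measurableSet_Icc.compl).2 (.of_forall fun y hy => ?_)
    have h1 : 1 ≤ |y - a| := by
      by_contra! h
      rw [abs_lt] at h
      exact hy ⟨by linarith, by linarith⟩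
    rw [norm_mul, Real.norm_of_nonneg (Real.rpow_nonneg (abs_nonneg _) _), eval_mul, mul_assoc]
    refine mul_le_mul ?_ (hD y) (abs_nonneg _) (by simp; positivity)
    simpa using abs_rpow_le_one_add_sq_pow s (y - a) (.inr h1)

theorem abs_rpow_sub_rpow_le {s b c : ℝ} (hs : 0 < s) (hb : 0 < b) (hc : 0 ≤ c)
    (hbc : |c - b| ≤ 1) :
    |c ^ s - b ^ s| ≤ (b ^ (s - 1) + s * 2 ^ (s - 1) * (b ^ s + 1)) * |c - b| := by
  rcases le_total s 1 with h1 | h1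
  · have key : |c ^ s - b ^ s| ≤ b ^ (s - 1) * |c - b| := by
      have hb' : b ^ s = b ^ (s - 1) * b := by rw [← Real.rpow_add_one hb.ne']; simp
      rcases hc.eq_or_lt with rfl | hc0
      · rw [Real.zero_rpow hs.ne', zero_sub, zero_sub, abs_neg, abs_neg, hb', abs_mul,
          abs_of_nonneg (Real.rpow_nonneg hb.le _)]
      have hc' : c ^ s = c ^ (s - 1) * c := by rw [← Real.rpow_add_one hc0.ne']; simp
      rcases le_total b c with h | h
      · have h2 := Real.rpow_le_rpow_of_nonpos hb h (by linarith : s - 1 ≤ 0)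
        rw [abs_of_nonneg (sub_nonneg.2 (Real.rpow_le_rpow hb.le h hs.le)),
          abs_of_nonneg (sub_nonneg.2 h), hb', hc']
        nlinarith
      · have h2 := Real.rpow_le_rpow_of_nonpos hc0 h (by linarith : s - 1 ≤ 0)
        rw [abs_of_nonpos (sub_nonpos.2 (Real.rpow_le_rpow hc h hs.le)),
          abs_of_nonpos (sub_nonpos.2 h), hb', hc']
        nlinarith
    refine key.trans (mul_le_mul_of_nonneg_right (le_add_of_nonneg_right ?_) (abs_nonneg _))
    positivity
  · have key : |c ^ s - b ^ s| ≤ (s * (b + 1) ^ (s - 1)) * |c - b| := by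
      refine Convex.norm_image_sub_le_of_norm_hasDerivWithin_le (s := Set.Icc 0 (b + 1))
        (f := fun x => x ^ s) (f' := fun x => s * x ^ (s - 1))
        (fun x _ => (Real.hasDerivAt_rpow_const (.inr h1)).hasDerivWithinAt) (fun x hx => ?_)
        (convex_Icc _ _) ⟨hb.le, by linarith⟩ ⟨hc, by linarith [(abs_le.1 hbc).2]⟩
      have := Real.rpow_nonneg hx.1 (s - 1)
      rw [Real.norm_of_nonneg (by positivity)]
      exact mul_le_mul_of_nonneg_left (Real.rpow_le_rpow hx.1 hx.2 (by linarith)) hs.le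
    refine key.trans (mul_le_mul_of_nonneg_right ?_ (abs_nonneg _))
    have h2 : (b + 1) ^ s ≤ 2 ^ (s - 1) * (b ^ s + 1 ^ s) :=
      mod_cast NNReal.rpow_add_le_mul_rpow_add_rpow ⟨b, hb.le⟩ 1 h1
    have h3 : (b + 1) ^ (s - 1) ≤ (b + 1) ^ s :=
      Real.rpow_le_rpow_of_exponent_le (by linarith) (by linarith)
    rw [Real.one_rpow] at h2
    have := Real.rpow_nonneg hb.le (s - 1)
    nlinarith [mul_le_mul_of_nonneg_left (h3.trans h2) hs.le]

theorem hasDerivAt_abs_rpow_of_ne_zero (s : ℝ) {u : ℝ} (hu : u ≠ 0) :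
    HasDerivAt (fun u : ℝ => |u| ^ s) (s * |u| ^ s / u) u := by
  convert (hasDerivAt_abs hu).rpow_const (p := s) (.inl (abs_ne_zero.2 hu)) using 1
  rw [Real.rpow_sub_one (abs_ne_zero.2 hu)]
  rcases hu.lt_or_gt with h | h
  · simp [abs_of_neg h, sign_neg h]; field_simp
  · simp [abs_of_pos h, sign_pos h]; field_simp

theorem hasDerivAt_integral_abs_sub_rpow_mul {s : ℝ} (hs : 0 < s) (a : ℝ) {g : ℝ → ℝ}
    (hg : Continuous g) {D : ℝ[X]} (hD : ∀ y, |g y| ≤ D.eval y * Real.exp (-y ^ 2)) :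
    HasDerivAt (fun b => ∫ y, |y - b| ^ s * g y) (-(s * ∫ y, |y - a| ^ s * g y / (y - a))) a := by
  have hint := fun r (hr : -1 < r) => integrable_abs_sub_rpow_mul hr a hg.abs (D := D) (by simpa)
  have hbound := ((hint (s - 1) (by linarith)).add
    (((hint s (by linarith)).add (hint 0 (by norm_num))).const_mul (s * 2 ^ (s - 1))))
  have hne : ∀ᵐ y : ℝ, y ≠ a := by simp [ae_iff]
  have h := hasFDerivAt_integral_of_dominated_loc_of_lip' (𝕜 := ℝ) (μ := volume)
    (F := fun b y => |y - b| ^ s * g y) (x₀ := a)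
    (F' := fun y => ContinuousLinearMap.toSpanSingleton ℝ (-(s * (|y - a| ^ s * g y / (y - a)))))
    (Metric.closedBall_mem_nhds a one_pos)
    (fun b _ => by
      have : Continuous fun y => |y - b| ^ s * g y :=
        ((continuous_id.sub continuous_const).abs.rpow_const fun _ => .inr hs.le).mul hg
      exact this.aestronglyMeasurable)
    (integrable_abs_sub_rpow_mul (by linarith) a hg hD)
    ?_ (hne.mono fun y hy b hb => ?_) hbound (hne.mono fun y hy => ?_)
  · have h2 := h.2.hasDerivAt
    rw [ContinuousLinearMap.integral_apply h.1] at h2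
    simpa [integral_neg, integral_const_mul] using h2
  · have hm : Measurable fun y => (-(s * (|y - a| ^ s * g y / (y - a)))) := by
      have := hg.measurable
      fun_prop
    exact ((ContinuousLinearMap.toSpanSingletonCLE (𝕜 := ℝ) (E := ℝ)).continuous.measurable.comp hm).aestronglyMeasurable
  · have hb1 : |(|y - b| - |y - a|)| ≤ |b - a| := by
      have := abs_abs_sub_abs_le_abs_sub (y - b) (y - a)
      rwa [show y - b - (y - a) = -(b - a) by ring, abs_neg] at this
    have := abs_rpow_sub_rpow_le hs (abs_pos.2 (sub_ne_zero.2 hy)) (abs_nonneg (y - b))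
      (hb1.trans (by simpa [Real.dist_eq] using hb))
    simp only [Pi.add_apply, Real.rpow_zero, one_mul, Real.norm_eq_abs]
    rw [← sub_mul, abs_mul]
    calc _ ≤ (|y - a| ^ (s - 1) + s * 2 ^ (s - 1) * (|y - a| ^ s + 1)) * |b - a| * |g y| := by
          refine mul_le_mul_of_nonneg_right (this.trans ?_) (abs_nonneg _)
          exact mul_le_mul_of_nonneg_left hb1 (by positivity)
      _ = _ := by ring
  · have := ((hasDerivAt_abs_rpow_of_ne_zero s (sub_ne_zero.2 hy)).comp a
      ((hasDerivAt_id a).const_sub y)).mul_const (g y)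
    refine this.hasFDerivAt.congr_fderiv ?_
    ext
    simp
    ring

theorem integral_eq_zero_of_hasDerivAt_off_finite {f f' : ℝ → ℝ} {s : Set ℝ} (hs : s.Finite)
    (hc : Continuous f) (hd : ∀ y ∉ s, HasDerivAt f (f' y) y) (hf : Integrable f)
    (hf' : Integrable f') : ∫ y, f' y = 0 := by
  obtain ⟨a, ha⟩ := hs.bddAbove
  obtain ⟨b, hb⟩ := hs.bddBelow
  have htop : Filter.Tendsto f Filter.atTop (nhds 0) :=
    tendsto_zero_of_hasDerivAt_of_integrableOn_Ioi (a := a) (f' := f')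
      (fun y hy => hd y fun h => (ha h).not_gt hy) hf'.integrableOn hf.integrableOn
  have hbot : Filter.Tendsto f Filter.atBot (nhds 0) :=
    tendsto_zero_of_hasDerivAt_of_integrableOn_Iic (a := b - 1) (f' := f')
      (fun y hy => hd y fun h => by
        have := hb h
        have : y ≤ b - 1 := hy
        linarith) hf'.integrableOn hf.integrableOn
  have h1 := intervalIntegral_tendsto_integral hf' (Filter.tendsto_neg_atTop_atBot (G := ℝ))
    Filter.tendsto_id
  have h2 : ∀ r : ℝ, ∫ y in (-r)..(id r), f' y = f r - f (-r) := fun r =>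
    integral_eq_of_hasDerivAt_off_countable f f' hs.countable hc.continuousOn
      (fun y hy => hd y hy.2) hf'.intervalIntegrable
  simp_rw [h2] at h1
  exact tendsto_nhds_unique h1
    (by simpa using htop.sub (hbot.comp Filter.tendsto_neg_atTop_atBot))

section GaussianWeight

variable {N : ℕ} {γ t : Fin N → ℝ}

/-- The Gaussian weight with algebraic singularities at the points `t j`. -/
noncomputable def singularGaussian (γ t : Fin N → ℝ) (y : ℝ) : ℝ :=
  Real.exp (-y ^ 2) * ∏ j, |y - t j| ^ γ j

theorem continuous_eval_mul_exp_mul_prod (hγ : ∀ j, 0 < γ j) (S : Finset (Fin N)) (q : ℝ[X]) :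
    Continuous fun y => q.eval y * (Real.exp (-y ^ 2) * ∏ j ∈ S, |y - t j| ^ γ j) := by
  have : Continuous fun y => ∏ j ∈ S, |y - t j| ^ γ j :=
    continuous_finsetProd _ fun j _ =>
      (continuous_id.sub continuous_const).abs.rpow_const fun _ => .inr (hγ j).le
  fun_prop

theorem abs_eval_mul_exp_mul_prod_le (hγ : ∀ j, 0 < γ j) (S : Finset (Fin N)) (q : ℝ[X]) (y : ℝ) :
    |q.eval y * (Real.exp (-y ^ 2) * ∏ j ∈ S, |y - t j| ^ γ j)| ≤
      ((1 + q ^ 2) * ∏ j ∈ S, (1 + (X - C (t j)) ^ 2) ^ ⌈|γ j|⌉₊).eval y * Real.exp (-y ^ 2) := by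
  have h1 : |q.eval y| ≤ 1 + q.eval y ^ 2 := by
    nlinarith [sq_abs (q.eval y), sq_nonneg (|q.eval y| - 1)]
  have h2 : ∏ j ∈ S, |y - t j| ^ γ j ≤ ∏ j ∈ S, (1 + (y - t j) ^ 2) ^ ⌈|γ j|⌉₊ :=
    Finset.prod_le_prod (fun j _ => by positivity) fun j _ =>
      abs_rpow_le_one_add_sq_pow (γ j) (y - t j) (.inl (hγ j).le)
  have h3 : 0 ≤ ∏ j ∈ S, |y - t j| ^ γ j := Finset.prod_nonneg fun j _ => by positivity
  rw [abs_mul, abs_mul, abs_of_nonneg h3, abs_of_pos (Real.exp_pos _), eval_mul, eval_prod]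
  simp only [eval_add, eval_one, eval_pow, eval_sub, eval_X, eval_C]
  calc _ ≤ (1 + q.eval y ^ 2) * (Real.exp (-y ^ 2) * ∏ j ∈ S, (1 + (y - t j) ^ 2) ^ ⌈|γ j|⌉₊) := by
        gcongr
    _ = _ := by ring

theorem eval_mul_singularGaussian_eq (j : Fin N) (q : ℝ[X]) (y : ℝ) :
    q.eval y * singularGaussian γ t y =
      |y - t j| ^ γ j *
        (q.eval y * (Real.exp (-y ^ 2) * ∏ k ∈ Finset.univ.erase j, |y - t k| ^ γ k)) := by
  rw [singularGaussian, ← Finset.mul_prod_erase _ _ (Finset.mem_univ j)]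
  ring

theorem continuous_eval_mul_singularGaussian (hγ : ∀ j, 0 < γ j) (q : ℝ[X]) :
    Continuous fun y => q.eval y * singularGaussian γ t y :=
  continuous_eval_mul_exp_mul_prod hγ _ q

theorem integrable_eval_mul_singularGaussian (hγ : ∀ j, 0 < γ j) (t : Fin N → ℝ) (q : ℝ[X]) :
    Integrable fun y => q.eval y * singularGaussian γ t y :=
  integrable_of_le_eval_mul_exp_neg_sq (continuous_eval_mul_singularGaussian hγ q)
    (abs_eval_mul_exp_mul_prod_le hγ Finset.univ q)

theorem integrable_eval_mul_singularGaussian_div (hγ : ∀ j, 0 < γ j) (t : Fin N → ℝ) (j : Fin N)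
    (q : ℝ[X]) : Integrable fun y => q.eval y * singularGaussian γ t y / (y - t j) := by
  refine (integrable_abs_sub_rpow_mul (s := γ j - 1) (by linarith [hγ j]) (t j)
    (continuous_eval_mul_exp_mul_prod hγ (Finset.univ.erase j) q)
    (abs_eval_mul_exp_mul_prod_le (t := t) hγ _ q)).mono ?_ ?_
  · have := (continuous_eval_mul_singularGaussian (t := t) hγ q).measurable
    exact Measurable.aestronglyMeasurable (by fun_prop)
  · have hne : ∀ᵐ y : ℝ, y ≠ t j := by simp [ae_iff]
    filter_upwards [hne] with y hy
    have hy' := abs_ne_zero.2 (sub_ne_zero.2 hy)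
    rw [eval_mul_singularGaussian_eq j, norm_div, norm_mul, norm_mul (_ ^ _), Real.rpow_sub_one hy',
      norm_div, Real.norm_eq_abs |y - t j|, abs_abs, Real.norm_eq_abs (y - t j)]
    exact le_of_eq (by ring)

/-- Integration of polynomials against `singularGaussian γ t`. -/
noncomputable def momentFunctional (hγ : ∀ j, 0 < γ j) (t : Fin N → ℝ) : ℝ[X] →ₗ[ℝ] ℝ where
  toFun q := ∫ y, q.eval y * singularGaussian γ t y
  map_add' p q := by
    simp only [eval_add, add_mul]
    exact integral_add (integrable_eval_mul_singularGaussian hγ t p)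
      (integrable_eval_mul_singularGaussian hγ t q)
  map_smul' c q := by
    simp only [eval_smul, smul_eq_mul, mul_assoc, RingHom.id_apply]
    exact integral_const_mul _ _

/-- Integration of polynomials against `singularGaussian γ t y / (y - t j)`. -/
noncomputable def poleFunctional (hγ : ∀ j, 0 < γ j) (t : Fin N → ℝ) (j : Fin N) :
    ℝ[X] →ₗ[ℝ] ℝ where
  toFun q := ∫ y, q.eval y * singularGaussian γ t y / (y - t j)
  map_add' p q := by
    simp only [eval_add, add_mul, add_div]
    exact integral_add (integrable_eval_mul_singularGaussian_div hγ t j p)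
      (integrable_eval_mul_singularGaussian_div hγ t j q)
  map_smul' c q := by
    simp only [eval_smul, smul_eq_mul, mul_assoc, mul_div_assoc, RingHom.id_apply]
    exact integral_const_mul _ _

theorem momentFunctional_apply (hγ : ∀ j, 0 < γ j) (q : ℝ[X]) :
    momentFunctional hγ t q = ∫ y, q.eval y * singularGaussian γ t y := rfl

theorem poleFunctional_apply (hγ : ∀ j, 0 < γ j) (j : Fin N) (q : ℝ[X]) :
    poleFunctional hγ t j q = ∫ y, q.eval y * singularGaussian γ t y / (y - t j) := rfl

theorem poleFunctional_X_sub_C_mul (hγ : ∀ j, 0 < γ j) (j : Fin N) (q : ℝ[X]) :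
    poleFunctional hγ t j ((X - C (t j)) * q) = momentFunctional hγ t q := by
  rw [poleFunctional_apply, momentFunctional_apply]
  have hne : ∀ᵐ y : ℝ, y ≠ t j := by simp [ae_iff]
  refine integral_congr_ae (hne.mono fun y hy => ?_)
  have := sub_ne_zero.2 hy
  simp only [eval_mul, eval_sub, eval_X, eval_C]
  field_simp

theorem momentFunctional_derivative (hγ : ∀ j, 0 < γ j) (q : ℝ[X]) :
    momentFunctional hγ t (derivative q) =
      2 * momentFunctional hγ t (X * q) - ∑ j, γ j * poleFunctional hγ t j q := by
  have hint1 := integrable_eval_mul_singularGaussian hγ t (derivative q)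
  have hint2 := (integrable_eval_mul_singularGaussian hγ t (X * q)).const_mul 2
  have hint12 : Integrable fun y => (derivative q).eval y * singularGaussian γ t y
      - 2 * ((X * q).eval y * singularGaussian γ t y) := hint1.sub hint2
  have hint3 : ∀ j ∈ Finset.univ,
      Integrable fun y => γ j * (q.eval y * singularGaussian γ t y / (y - t j)) :=
    fun j _ => (integrable_eval_mul_singularGaussian_div hγ t j q).const_mul (γ j)
  have h := integral_eq_zero_of_hasDerivAt_off_finite (Set.finite_range t)
    (continuous_eval_mul_singularGaussian (t := t) hγ q)
    (f' := fun y => (derivative q).eval y * singularGaussian γ t y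
      - 2 * ((X * q).eval y * singularGaussian γ t y)
      + ∑ j, γ j * (q.eval y * singularGaussian γ t y / (y - t j))) (fun y hy => ?_)
    (integrable_eval_mul_singularGaussian hγ t q)
    (hint12.add (integrable_finsetSum _ hint3))
  · rw [integral_add hint12 (integrable_finsetSum _ hint3), integral_sub hint1 hint2,
      integral_finsetSum _ hint3] at h
    simp only [integral_const_mul, ← momentFunctional_apply hγ, ← poleFunctional_apply hγ] at h
    linarith
  · have hy' : ∀ j, y - t j ≠ 0 := fun j hj => hy ⟨j, (sub_eq_zero.1 hj).symm⟩
    have h1 := HasDerivAt.fun_finsetProd (u := Finset.univ) fun j _ =>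
      (hasDerivAt_abs_rpow_of_ne_zero (γ j) (hy' j)).comp y ((hasDerivAt_id y).sub_const (t j))
    have h2 := (q.hasDerivAt y).mul (((hasDerivAt_pow 2 y).neg.exp).mul h1)
    refine h2.congr_deriv ?_
    have h3 : ∀ j, (∏ k ∈ Finset.univ.erase j, |y - t k| ^ γ k) *
        (γ j * |y - t j| ^ γ j / (y - t j)) = (∏ k, |y - t k| ^ γ k) * (γ j / (y - t j)) := by
      intro j
      rw [← Finset.mul_prod_erase _ _ (Finset.mem_univ j)]
      ring
    simp only [Function.comp_def, id, smul_eq_mul, mul_one, h3]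
    simp only [← Finset.mul_sum, singularGaussian, eval_mul, eval_X]
    have h4 : ∑ j, γ j * (q.eval y *
        (Real.exp (-y ^ 2) * ∏ k, |y - t k| ^ γ k) / (y - t j)) =
        q.eval y * (Real.exp (-y ^ 2) * ((∏ k, |y - t k| ^ γ k) * ∑ j, γ j / (y - t j))) := by
      simp only [Finset.mul_sum]
      exact Finset.sum_congr rfl fun j _ => by ring
    rw [h4]
    simp
    ring

theorem hasDerivAt_momentFunctional_update (hγ : ∀ j, 0 < γ j) (t : Fin N → ℝ) (j : Fin N)
    (q : ℝ[X]) :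
    HasDerivAt (fun s => momentFunctional hγ (Function.update t j s) q)
      (-(γ j * poleFunctional hγ t j q)) (t j) := by
  have h := hasDerivAt_integral_abs_sub_rpow_mul (hγ j) (t j)
    (continuous_eval_mul_exp_mul_prod hγ (Finset.univ.erase j) q)
    (abs_eval_mul_exp_mul_prod_le (t := t) hγ _ q)
  simp only [← eval_mul_singularGaussian_eq] at h
  refine h.congr_of_eventuallyEq (.of_forall fun s => ?_)
  refine integral_congr_ae (.of_forall fun y => ?_)
  simp only [eval_mul_singularGaussian_eq j, Function.update_self]
  congr 3
  exact Finset.prod_congr rfl fun k hk => by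
    rw [Function.update_of_ne (Finset.ne_of_mem_erase hk)]

end GaussianWeight

section OrthogonalPolynomials

variable {L : ℝ[X] →ₗ[ℝ] ℝ} {P : ℕ → ℝ[X]}

theorem degree_sub_C_coeff_mul_lt {q p : ℝ[X]} (hp : p.Monic) (hq : q.degree < (p.natDegree + 1 : ℕ)) :
    (q - C (q.coeff p.natDegree) * p).degree < p.natDegree := by
  rw [degree_lt_iff_coeff_zero] at hq ⊢
  intro m hm
  rcases hm.eq_or_lt with rfl | hm
  · simp [hp]
  · simp [hq m hm, coeff_eq_zero_of_natDegree_lt hm]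

theorem map_mul_eq_zero_of_degree_lt (hmonic : ∀ n, (P n).Monic) (hdeg : ∀ n, (P n).natDegree = n)
    (horth : ∀ m n, m ≠ n → L (P m * P n) = 0) {n d : ℕ} (hdn : d ≤ n) {q : ℝ[X]}
    (hq : q.degree < d) : L (P n * q) = 0 := by
  induction d generalizing q with
  | zero =>
    have : q = 0 := by
      rw [← degree_eq_bot]
      exact Nat.WithBot.lt_zero_iff.1 (by simpa using hq)
    simp [this]
  | succ d ih =>
    have h := degree_sub_C_coeff_mul_lt (hmonic d) (q := q) (by rwa [hdeg])
    rw [hdeg] at h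
    have h1 := ih (by omega) h
    rw [mul_sub, mul_left_comm, map_sub, ← smul_eq_C_mul, map_smul, horth _ _ (by omega)] at h1
    simpa using h1

theorem map_mul_eq_coeff_mul (hmonic : ∀ n, (P n).Monic) (hdeg : ∀ n, (P n).natDegree = n)
    (horth : ∀ m n, m ≠ n → L (P m * P n) = 0) {n : ℕ} {q : ℝ[X]} (hq : q.natDegree ≤ n) :
    L (P n * q) = q.coeff n * L (P n * P n) := by
  have h := degree_sub_C_coeff_mul_lt (hmonic n) (q := q) (by
    rw [hdeg]
    exact degree_le_natDegree.trans_lt (by exact_mod_cast Nat.lt_succ_of_le hq))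
  rw [hdeg] at h
  have h1 := map_mul_eq_zero_of_degree_lt hmonic hdeg horth le_rfl h
  rw [mul_sub, mul_left_comm, map_sub, ← smul_eq_C_mul, map_smul, smul_eq_mul] at h1
  linarith

theorem natDegree_X_mul_sub_le (hmonic : ∀ n, (P n).Monic) (hdeg : ∀ n, (P n).natDegree = n)
    (n : ℕ) : (X * P n - P (n + 1)).natDegree ≤ n := by
  rw [natDegree_le_iff_coeff_eq_zero]
  intro m hm
  obtain ⟨k, rfl⟩ : ∃ k, m = k + 1 := ⟨m - 1, by omega⟩
  rw [coeff_sub, coeff_X_mul]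
  rcases (show n ≤ k by omega).eq_or_lt with rfl | h
  · have h1 := (hmonic n).coeff_natDegree
    have h2 := (hmonic (n + 1)).coeff_natDegree
    rw [hdeg] at h1 h2
    rw [h1, h2, sub_self]
  · rw [coeff_eq_zero_of_natDegree_lt (by rw [hdeg]; omega),
      coeff_eq_zero_of_natDegree_lt (by rw [hdeg]; omega), sub_self]

theorem map_X_mul_sq (hmonic : ∀ n, (P n).Monic) (hdeg : ∀ n, (P n).natDegree = n)
    (horth : ∀ m n, m ≠ n → L (P m * P n) = 0) (n : ℕ) :
    L (X * (P n * P n)) = ((X * P n).coeff n - (P (n + 1)).coeff n) * L (P n * P n) := by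
  have h := map_mul_eq_coeff_mul hmonic hdeg horth (natDegree_X_mul_sub_le hmonic hdeg n)
  rw [mul_sub, map_sub, horth n (n + 1) (by omega), sub_zero, coeff_sub] at h
  rw [← h]
  ring_nf

theorem map_X_mul_mul (hmonic : ∀ n, (P n).Monic) (hdeg : ∀ n, (P n).natDegree = n)
    (horth : ∀ m n, m ≠ n → L (P m * P n) = 0) (n : ℕ) :
    L (X * (P (n + 1) * P n)) = L (P (n + 1) * P (n + 1)) := by
  have h := map_mul_eq_coeff_mul hmonic hdeg horth (q := X * P n) (n := n + 1)
    (natDegree_mul_le.trans (by rw [hdeg]; simp; omega))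
  have h1 := (hmonic n).coeff_natDegree
  rw [hdeg] at h1
  rw [coeff_X_mul, h1, one_mul] at h
  rw [← h]
  ring_nf

theorem map_X_mul_X_mul_mul (hmonic : ∀ n, (P n).Monic) (hdeg : ∀ n, (P n).natDegree = n)
    (horth : ∀ m n, m ≠ n → L (P m * P n) = 0) (n : ℕ) :
    L (X * (X * (P (n + 1) * P n))) = ((X * P n).coeff n - (P (n + 2)).coeff (n + 1)) *
      L (P (n + 1) * P (n + 1)) := by
  have h := map_mul_eq_coeff_mul hmonic hdeg horth (q := X * (X * P n - P (n + 1))) (n := n + 1)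
    (natDegree_mul_le.trans (by
      have := natDegree_X_mul_sub_le hmonic hdeg n
      simp; omega))
  have h1 := map_X_mul_sq hmonic hdeg horth (n + 1)
  rw [coeff_X_mul] at h1
  rw [coeff_X_mul, coeff_sub] at h
  have h2 : X * (X * (P (n + 1) * P n)) =
    P (n + 1) * (X * (X * P n - P (n + 1))) + X * (P (n + 1) * P (n + 1)) := by ring
  rw [h2, map_add, h, h1]
  ring

theorem map_derivative_mul (hmonic : ∀ n, (P n).Monic) (hdeg : ∀ n, (P n).natDegree = n)
    (horth : ∀ m n, m ≠ n → L (P m * P n) = 0) (n : ℕ) :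
    L (derivative (P (n + 1) * P n)) = (n + 1) * L (P n * P n) := by
  have h1 := map_mul_eq_coeff_mul hmonic hdeg horth (q := derivative (P (n + 1))) (n := n)
    ((natDegree_derivative_le _).trans (by rw [hdeg]; simp))
  have h2 := map_mul_eq_zero_of_degree_lt hmonic hdeg horth (q := derivative (P n)) (n := n + 1)
    le_rfl (by
      refine (degree_derivative_le).trans_lt (degree_le_natDegree.trans_lt ?_)
      rw [hdeg]
      exact_mod_cast n.lt_succ_self)
  have h3 := (hmonic (n + 1)).coeff_natDegree
  rw [hdeg] at h3
  rw [coeff_derivative, h3] at h1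
  rw [derivative_mul, map_add, h2, add_zero, mul_comm, h1]
  ring

theorem map_derivative_sq (hmonic : ∀ n, (P n).Monic) (hdeg : ∀ n, (P n).natDegree = n)
    (horth : ∀ m n, m ≠ n → L (P m * P n) = 0) (n : ℕ) :
    L (derivative (P n * P n)) = 0 := by
  have h1 := map_mul_eq_coeff_mul hmonic hdeg horth (q := derivative (P n)) (n := n)
    ((natDegree_derivative_le _).trans (by rw [hdeg]; simp))
  rw [coeff_derivative, coeff_eq_zero_of_natDegree_lt (by rw [hdeg]; omega), zero_mul, zero_mul]
    at h1
  rw [derivative_mul, map_add, mul_comm, h1, add_zero]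

theorem map_derivative_X_mul_mul (hmonic : ∀ n, (P n).Monic) (hdeg : ∀ n, (P n).natDegree = n)
    (horth : ∀ m n, m ≠ n → L (P m * P n) = 0) (n : ℕ) :
    L (derivative (X * (P (n + 1) * P n))) = -((P (n + 1)).coeff n * L (P n * P n)) := by
  have h3 := (hmonic (n + 1)).coeff_natDegree
  rw [hdeg] at h3
  have h1 := map_mul_eq_coeff_mul hmonic hdeg horth (n := n)
    (q := X * derivative (P (n + 1)) - C ((n : ℝ) + 1) * P (n + 1)) (by
      rw [natDegree_le_iff_coeff_eq_zero]
      intro m hm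
      obtain ⟨k, rfl⟩ : ∃ k, m = k + 1 := ⟨m - 1, by omega⟩
      rw [coeff_sub, coeff_X_mul, coeff_derivative, coeff_C_mul]
      rcases (show n ≤ k by omega).eq_or_lt with rfl | h
      · ring
      · rw [coeff_eq_zero_of_natDegree_lt (by rw [hdeg]; omega)]
        ring)
  have hc : (X * derivative (P (n + 1))).coeff n = n * (P (n + 1)).coeff n := by
    cases n with
    | zero => simp
    | succ k => rw [coeff_X_mul, coeff_derivative]; push_cast; ring
  rw [coeff_sub, hc, coeff_C_mul] at h1
  have h2 := map_mul_eq_zero_of_degree_lt hmonic hdeg horth (q := X * derivative (P n))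
    (n := n + 1) le_rfl (by
      rw [degree_lt_iff_coeff_zero]
      intro m hm
      obtain ⟨k, rfl⟩ : ∃ k, m = k + 1 := ⟨m - 1, by omega⟩
      rw [coeff_X_mul, coeff_derivative, coeff_eq_zero_of_natDegree_lt (by rw [hdeg]; omega),
        zero_mul])
  have h0 := horth (n + 1) n (by omega)
  have hs : derivative (X * (P (n + 1) * P n)) = P (n + 1) * P n +
      P n * (X * derivative (P (n + 1)) - C ((n : ℝ) + 1) * P (n + 1)) +
      ((n : ℝ) + 1) • (P (n + 1) * P n) + P (n + 1) * (X * derivative (P n)) := by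
    rw [smul_eq_C_mul]
    simp only [derivative_mul, derivative_X]
    ring
  rw [hs, map_add, map_add, map_add, map_smul, h0, h1, h2]
  simp
  ring

theorem pole_mul_pole_sub {K : ℝ[X] →ₗ[ℝ] ℝ} {a : ℝ} (hmonic : ∀ n, (P n).Monic)
    (hdeg : ∀ n, (P n).natDegree = n) (horth : ∀ m n, m ≠ n → L (P m * P n) = 0)
    (hK : ∀ q, K ((X - C a) * q) = L q) (n : ℕ) :
    K (P (n + 1) * P n) * (K (P (n + 1) * P n) - L (P n * P n)) =
      K (P (n + 1) * P (n + 1)) * K (P n * P n) := by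
  have key : ∀ p q : ℝ[X], K (p * q) = q.eval a * K p + L (p * (q /ₘ (X - C a))) := by
    intro p q
    have h : p * q = q.eval a • p + (X - C a) * (p * (q /ₘ (X - C a))) := by
      conv_lhs => rw [← modByMonic_add_div q (X - C a), modByMonic_X_sub_C_eq_C_eval]
      rw [smul_eq_C_mul]
      ring
    rw [h, map_add, map_smul, hK, smul_eq_mul]
  have hlow : ∀ m k, k ≤ m → L (P m * (P k /ₘ (X - C a))) = 0 := by
    intro m k hkm
    rcases Nat.eq_zero_or_pos k with rfl | hk
    · rw [(divByMonic_eq_zero_iff (monic_X_sub_C a)).2, mul_zero, map_zero]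
      rw [degree_X_sub_C, degree_eq_natDegree (hmonic 0).ne_zero, hdeg]
      simp
    · refine map_mul_eq_zero_of_degree_lt hmonic hdeg horth (d := m) le_rfl ?_
      refine degree_le_natDegree.trans_lt ?_
      rw [natDegree_divByMonic _ (monic_X_sub_C a), hdeg, natDegree_X_sub_C]
      exact_mod_cast (by omega : k - 1 < m)
  have htop : L (P n * (P (n + 1) /ₘ (X - C a))) = L (P n * P n) := by
    have hd : (P (n + 1) /ₘ (X - C a)).natDegree = n := by
      rw [natDegree_divByMonic _ (monic_X_sub_C a), hdeg, natDegree_X_sub_C, Nat.add_sub_cancel]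
    have hl := leadingCoeff_divByMonic_X_sub_C (P (n + 1)) (by
      rw [degree_eq_natDegree (hmonic _).ne_zero, hdeg]; exact_mod_cast n.succ_ne_zero) a
    rw [leadingCoeff, hd, (hmonic _).leadingCoeff] at hl
    rw [map_mul_eq_coeff_mul hmonic hdeg horth hd.le, hl, one_mul]
  have h1 := key (P (n + 1)) (P n)
  have h2 := key (P n) (P (n + 1))
  rw [mul_comm (P n) (P (n + 1)), htop] at h2
  rw [hlow _ _ n.le_succ, add_zero] at h1
  rw [key (P (n + 1)) (P (n + 1)), key (P n) (P n), hlow _ _ le_rfl, hlow _ _ le_rfl]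
  have h3 : K (P (n + 1) * P n) - L (P n * P n) = (P (n + 1)).eval a * K (P n) := by
    rw [h2]; ring
  rw [h3, h1]
  ring

end OrthogonalPolynomials

section PartialDerivatives

variable {N : ℕ} {f g : (Fin N → ℝ) → ℝ} {x : Fin N → ℝ} {U : Set (Fin N → ℝ)}

theorem eventually_update_mem (hU : IsOpen U) (hx : x ∈ U) (j : Fin N) :
    ∀ᶠ s in nhds (x j), Function.update x j s ∈ U := by
  have h : Continuous fun s => Function.update x j s := continuous_const.update j continuous_id
  exact h.continuousAt.eventually (hU.mem_nhds (by simpa using hx))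

theorem pd_congr (hU : IsOpen U) (hx : x ∈ U) (hfg : ∀ z ∈ U, f z = g z) (j : Fin N) :
    pd j f x = pd j g x :=
  Filter.EventuallyEq.deriv_eq ((eventually_update_mem hU hx j).mono fun _ hs => hfg _ hs)

theorem hasDerivAt_comp_update (hf : DifferentiableAt ℝ f x) (j : Fin N) :
    HasDerivAt (fun s => f (Function.update x j s)) (fderiv ℝ f x (Pi.single j 1)) (x j) := by
  refine HasFDerivAt.comp_hasDerivAt (x j) ?_ (hasDerivAt_update x j (x j))
  rw [Function.update_eq_self]
  exact hf.hasFDerivAt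

theorem pd_eq_fderiv (hf : DifferentiableAt ℝ f x) (j : Fin N) :
    pd j f x = fderiv ℝ f x (Pi.single j 1) :=
  (hasDerivAt_comp_update hf j).deriv

theorem differentiableAt_fderiv_apply (hU : IsOpen U) (hx : x ∈ U) (hf : ContDiffOn ℝ 2 f U)
    (v : Fin N → ℝ) : DifferentiableAt ℝ (fun z => fderiv ℝ f z v) x :=
  (((hf.contDiffAt (hU.mem_nhds hx)).fderiv_right (m := 1) (by norm_num)).differentiableAt
    (by norm_num)).clm_apply (differentiableAt_const v)

theorem pd_pd_eq (hU : IsOpen U) (hx : x ∈ U) (hf : ContDiffOn ℝ 2 f U) (j k : Fin N) :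
    pd j (pd k f) x = fderiv ℝ (fderiv ℝ f) x (Pi.single j 1) (Pi.single k 1) := by
  rw [pd_congr hU hx (fun z hz => pd_eq_fderiv
      ((hf.contDiffAt (hU.mem_nhds hz)).differentiableAt (by norm_num)) k) j,
    pd_eq_fderiv (differentiableAt_fderiv_apply hU hx hf _)]
  have h := ((hf.contDiffAt (hU.mem_nhds hx)).fderiv_right (m := 1) (by norm_num)).differentiableAt
    (by norm_num)
  rw [fderiv_clm_apply h (differentiableAt_const _)]
  simp

theorem pd_pd_comm (hU : IsOpen U) (hx : x ∈ U) (hf : ContDiffOn ℝ 2 f U) (j k : Fin N) :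
    pd j (pd k f) x = pd k (pd j f) x := by
  rw [pd_pd_eq hU hx hf, pd_pd_eq hU hx hf]
  exact ((hf.contDiffAt (hU.mem_nhds hx)).isSymmSndFDerivAt (by simp)).eq _ _

theorem sum_pd_pd (hU : IsOpen U) (hx : x ∈ U) (hf : ContDiffOn ℝ 2 f U) (j : Fin N) :
    ∑ k, pd k (pd j f) x = pd j (fun z => ∑ k, pd k f z) x := by
  have hpd : ∀ z ∈ U, ∑ k, pd k f z = ∑ k, fderiv ℝ f z (Pi.single k 1) := fun z hz =>
    Finset.sum_congr rfl fun k _ => pd_eq_fderiv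
      ((hf.contDiffAt (hU.mem_nhds hz)).differentiableAt (by norm_num)) k
  rw [pd_congr hU hx hpd, pd, (HasDerivAt.fun_sum fun k _ => hasDerivAt_comp_update
    (differentiableAt_fderiv_apply hU hx hf (Pi.single k 1)) j).deriv]
  refine Finset.sum_congr rfl fun k _ => ?_
  rw [pd_pd_comm hU hx hf, ← pd_eq_fderiv (differentiableAt_fderiv_apply hU hx hf _)]
  exact pd_congr hU hx (fun z hz => pd_eq_fderiv
    ((hf.contDiffAt (hU.mem_nhds hz)).differentiableAt (by norm_num)) k) j

end PartialDerivatives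

section MovingPolynomials

variable {N : ℕ} {γ : Fin N → ℝ}

theorem map_mul_eq_sum_coeff (L : ℝ[X] →ₗ[ℝ] ℝ) (q : ℝ[X]) {Q : ℝ[X]} {d : ℕ}
    (hQ : Q.natDegree ≤ d) :
    L (q * Q) = ∑ k ∈ Finset.range (d + 1), Q.coeff k * L (q * X ^ k) := by
  conv_lhs => rw [Q.as_sum_range_C_mul_X_pow' (Nat.lt_succ_of_le hQ)]
  rw [Finset.mul_sum, map_sum]
  refine Finset.sum_congr rfl fun k _ => ?_
  rw [mul_left_comm, ← smul_eq_C_mul, map_smul, smul_eq_mul]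

theorem hasDerivAt_momentFunctional_mul (hγ : ∀ j, 0 < γ j) (t : Fin N → ℝ) (j : Fin N)
    (q : ℝ[X]) {Q : ℝ → ℝ[X]} {Q' : ℝ[X]} {d : ℕ}
    (hQ : ∀ᶠ s in nhds (t j), (Q s).natDegree ≤ d) (hQ' : Q'.natDegree ≤ d)
    (hc : ∀ k, HasDerivAt (fun s => (Q s).coeff k) (Q'.coeff k) (t j)) :
    HasDerivAt (fun s => momentFunctional hγ (Function.update t j s) (q * Q s))
      (momentFunctional hγ t (q * Q') - γ j * poleFunctional hγ t j (q * Q (t j))) (t j) := by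
  have h := HasDerivAt.fun_sum (u := Finset.range (d + 1)) fun k _ =>
    (hc k).mul (hasDerivAt_momentFunctional_update hγ t j (q * X ^ k))
  refine (h.congr_of_eventuallyEq ?_).congr_deriv ?_
  · exact hQ.mono fun s hs => map_mul_eq_sum_coeff _ q hs
  · rw [map_mul_eq_sum_coeff _ q hQ', map_mul_eq_sum_coeff _ q hQ.self_of_nhds, Finset.mul_sum,
      ← Finset.sum_sub_distrib]
    refine Finset.sum_congr rfl fun k _ => ?_
    rw [Function.update_eq_self]
    ring

theorem exists_hasDerivAt_coeff {Q : ℝ → ℝ[X]} {s : ℝ} {n : ℕ}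
    (hdiff : ∀ k, DifferentiableAt ℝ (fun s => (Q s).coeff k) s)
    (hQ : ∀ᶠ s in nhds s, (Q s).Monic ∧ (Q s).natDegree = n) :
    ∃ Q' : ℝ[X], Q'.degree < n ∧
      ∀ k, HasDerivAt (fun s => (Q s).coeff k) (Q'.coeff k) s := by
  have hcoeff : ∀ k, (∑ i ∈ Finset.range n, monomial i (deriv (fun s => (Q s).coeff i) s)).coeff k =
      if k < n then deriv (fun s => (Q s).coeff k) s else 0 := by
    intro k
    simp [finsetSum_coeff, coeff_monomial]
  refine ⟨∑ i ∈ Finset.range n, monomial i (deriv (fun s => (Q s).coeff i) s), ?_, fun k => ?_⟩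
  · rw [degree_lt_iff_coeff_zero]
    intro m hm
    rw [hcoeff, if_neg (by omega)]
  · rw [hcoeff]
    split_ifs with h
    · exact (hdiff k).hasDerivAt
    · refine (hasDerivAt_const s (if k = n then (1 : ℝ) else 0)).congr_of_eventuallyEq
        (hQ.mono fun u hu => ?_)
      show (Q u).coeff k = _
      split_ifs with hk
      · have := hu.1.coeff_natDegree
        rwa [hu.2, ← hk] at this
      · exact coeff_eq_zero_of_natDegree_lt (by omega)

variable {U : Set (Fin N → ℝ)} {P : ℕ → (Fin N → ℝ) → ℝ[X]} {x : Fin N → ℝ}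

theorem hasDerivAt_momentFunctional_sq (hγ : ∀ j, 0 < γ j) (hU : IsOpen U)
    (hmonic : ∀ n, ∀ x ∈ U, (P n x).Monic) (hdeg : ∀ n, ∀ x ∈ U, (P n x).natDegree = n)
    (horth : ∀ x ∈ U, ∀ m n, m ≠ n → momentFunctional hγ x (P m x * P n x) = 0)
    (hdiff : ∀ n k, ∀ x ∈ U, DifferentiableAt ℝ (fun x => (P n x).coeff k) x)
    (hx : x ∈ U) (n : ℕ) (j : Fin N) :
    HasDerivAt (fun s => momentFunctional hγ (Function.update x j s)
        (P n (Function.update x j s) * P n (Function.update x j s)))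
      (-(γ j * poleFunctional hγ x j (P n x * P n x))) (x j) := by
  have hmem := eventually_update_mem hU hx j
  obtain ⟨Q', hQ'deg, hQ'⟩ := exists_hasDerivAt_coeff
    (fun k => (hasDerivAt_comp_update (hdiff n k x hx) j).differentiableAt)
    (hmem.mono fun s hs => ⟨hmonic n _ hs, hdeg n _ hs⟩)
  have h := hasDerivAt_momentFunctional_mul hγ x j (P n x) (d := n)
    (hmem.mono fun s hs => (hdeg n _ hs).le) (natDegree_le_of_degree_le hQ'deg.le) hQ'
  rw [Function.update_eq_self, map_mul_eq_zero_of_degree_lt (fun m => hmonic m x hx)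
    (fun m => hdeg m x hx) (horth x hx) le_rfl hQ'deg, zero_sub] at h
  refine h.congr_of_eventuallyEq (hmem.mono fun s hs => ?_)
  have h1 := (hmonic n x hx).coeff_natDegree
  rw [hdeg n x hx] at h1
  have h2 := map_mul_eq_coeff_mul (fun m => hmonic m _ hs) (fun m => hdeg m _ hs) (horth _ hs)
    (hdeg n x hx).le
  rw [h1, one_mul, mul_comm] at h2
  exact h2.symm

theorem hasDerivAt_coeff_update (hγ : ∀ j, 0 < γ j) (hU : IsOpen U)
    (hmonic : ∀ n, ∀ x ∈ U, (P n x).Monic) (hdeg : ∀ n, ∀ x ∈ U, (P n x).natDegree = n)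
    (horth : ∀ x ∈ U, ∀ m n, m ≠ n → momentFunctional hγ x (P m x * P n x) = 0)
    (hdiff : ∀ n k, ∀ x ∈ U, DifferentiableAt ℝ (fun x => (P n x).coeff k) x)
    (hx : x ∈ U) (n : ℕ) (hne : momentFunctional hγ x (P n x * P n x) ≠ 0) (j : Fin N) :
    HasDerivAt (fun s => (P (n + 1) (Function.update x j s)).coeff n)
      (γ j / momentFunctional hγ x (P n x * P n x) *
        poleFunctional hγ x j (P (n + 1) x * P n x)) (x j) := by
  have hmem := eventually_update_mem hU hx j
  obtain ⟨Q', hQ'deg, hQ'⟩ := exists_hasDerivAt_coeff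
    (fun k => (hasDerivAt_comp_update (hdiff (n + 1) k x hx) j).differentiableAt)
    (hmem.mono fun s hs => ⟨hmonic (n + 1) _ hs, hdeg (n + 1) _ hs⟩)
  have h := hasDerivAt_momentFunctional_mul hγ x j (P n x) (d := n + 1)
    (hmem.mono fun s hs => (hdeg (n + 1) _ hs).le) (natDegree_le_of_degree_le hQ'deg.le) hQ'
  have hQ'n : Q'.natDegree ≤ n := by
    rw [natDegree_le_iff_coeff_eq_zero]
    exact fun m hm => coeff_eq_zero_of_degree_lt (hQ'deg.trans_le (by exact_mod_cast hm))
  have h0 := h.unique ((hasDerivAt_const (x j) (0 : ℝ)).congr_of_eventuallyEq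
    (hmem.mono fun s hs => (congrArg _ (mul_comm _ _)).trans
      (map_mul_eq_zero_of_degree_lt (fun m => hmonic m _ hs) (fun m => hdeg m _ hs)
        (horth _ hs) le_rfl (degree_le_natDegree.trans_lt (by
          rw [hdeg n x hx]; exact_mod_cast n.lt_succ_self)))))
  rw [Function.update_eq_self, map_mul_eq_coeff_mul (fun m => hmonic m x hx)
    (fun m => hdeg m x hx) (horth x hx) hQ'n, mul_comm (P n x) (P (n + 1) x)] at h0
  refine (hQ' n).congr_deriv ?_
  field_simp
  linarith

end MovingPolynomials

theorem sum_coeff_sub_coeff {P : ℕ → ℝ[X]} (n : ℕ) :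
    ∑ i ∈ Finset.range (n + 1), ((X * P i).coeff i - (P (i + 1)).coeff i) = -(P (n + 1)).coeff n := by
  induction n with
  | zero => simp
  | succ n ih => rw [Finset.sum_range_succ, ih, coeff_X_mul]; ring

theorem sign_mul_sqrt_sq (u c : ℝ) (hc : 0 ≤ c) : Real.sign u * √((c * u) ^ 2) = c * u := by
  rw [Real.sqrt_sq_eq_abs, abs_mul, abs_of_nonneg hc]
  rcases lt_trichotomy u 0 with h | rfl | h
  · rw [Real.sign_of_neg h, abs_of_neg h]; ring
  · simp
  · rw [Real.sign_of_pos h, abs_of_pos h]; ring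

theorem sigma_form_painleve_IV
    (N : ℕ) (hN : 1 ≤ N) (γ : Fin N → ℝ) (hγ : ∀ j, 0 < γ j)
    (U : Set (Fin N → ℝ)) (hU : IsOpen U) (hUinj : ∀ x ∈ U, Function.Injective x)
    (w : (Fin N → ℝ) → ℝ → ℝ)
    (hw : ∀ x ∈ U, ∀ y : ℝ, w x y = Real.exp (-y ^ 2) * ∏ j, |y - x j| ^ γ j)
    (P : ℕ → (Fin N → ℝ) → Polynomial ℝ)
    (hPmonic : ∀ n, ∀ x ∈ U, (P n x).Monic) (hPdeg : ∀ n, ∀ x ∈ U, (P n x).natDegree = n)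
    (horth : ∀ m n, m ≠ n → ∀ x ∈ U, ∫ y : ℝ, (P m x).eval y * (P n x).eval y * w x y = 0)
    (h : ℕ → (Fin N → ℝ) → ℝ)
    (hh : ∀ n, ∀ x ∈ U, h n x = ∫ y : ℝ, ((P n x).eval y) ^ 2 * w x y)
    (hhpos : ∀ n, ∀ x ∈ U, 0 < h n x)
    (β : ℕ → (Fin N → ℝ) → ℝ) (hβ0 : ∀ x ∈ U, β 0 x = 0)
    (hβ : ∀ n, ∀ x ∈ U, β (n + 1) x = h (n + 1) x / h n x)
    (α : ℕ → (Fin N → ℝ) → ℝ)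
    (hα : ∀ n, ∀ x ∈ U, α n x = (∫ y : ℝ, y * ((P n x).eval y) ^ 2 * w x y) / h n x)
    (p : ℕ → (Fin N → ℝ) → ℝ) (hp0 : ∀ x ∈ U, p 0 x = 0)
    (hp : ∀ n, ∀ x ∈ U, p (n + 1) x = (P (n + 1) x).coeff n)
    (R : ℕ → Fin N → (Fin N → ℝ) → ℝ)
    (hR : ∀ n j, ∀ x ∈ U, R n j x = γ j / h n x * ∫ y : ℝ, ((P n x).eval y) ^ 2 * w x y / (y - x j))
    (r : ℕ → Fin N → (Fin N → ℝ) → ℝ) (hr0 : ∀ j, ∀ x ∈ U, r 0 j x = 0)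
    (hr : ∀ n j, ∀ x ∈ U, r (n + 1) j x = γ j / h n x * ∫ y : ℝ, (P (n + 1) x).eval y * (P n x).eval y * w x y / (y - x j))
    (hPC2 : ∀ m k, ContDiffOn ℝ 2 (fun x => (P m x).coeff k) U)
    (hhC2 : ∀ m, ContDiffOn ℝ 2 (h m) U)
    (hαC2 : ∀ m, ContDiffOn ℝ 2 (α m) U)
    (hβC2 : ∀ m, ContDiffOn ℝ 2 (β m) U)
    (hpC2 : ∀ m, ContDiffOn ℝ 2 (p m) U)
    (hRC2 : ∀ m j, ContDiffOn ℝ 2 (R m j) U)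
    (hrC2 : ∀ m j, ContDiffOn ℝ 2 (r m j) U)
    (σ : ℕ → (Fin N → ℝ) → ℝ)
    (hσ : ∀ n, ∀ x ∈ U, σ n x = ∑ k, pd k (fun y => Real.log (∏ i ∈ Finset.range n, h i y)) x)
    (n : ℕ) (hn : 1 ≤ n) (x : Fin N → ℝ) (hx : x ∈ U) (hRne : ∀ j, R n j x ≠ 0) :
    (∀ j, 0 ≤ ((pd j (pd j (σ n)) x + ∑ k ∈ Finset.univ.erase j, pd k (pd j (σ n)) x) ^ 2
        + 4 * (2 * (n : ℝ) + ∑ k, pd k (σ n) x) * pd j (σ n) x * (pd j (σ n) x - 2 * γ j))) ∧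
      σ n x = (∑ j, x j * pd j (σ n) x)
        - (1 / 2) * ∑ j, Real.sign (R n j x + R (n - 1) j x) * Real.sqrt ((pd j (pd j (σ n)) x + ∑ k ∈ Finset.univ.erase j, pd k (pd j (σ n)) x) ^ 2
        + 4 * (2 * (n : ℝ) + ∑ k, pd k (σ n) x) * pd j (σ n) x * (pd j (σ n) x - 2 * γ j)) := by
  
  have hw' : ∀ x ∈ U, w x = singularGaussian γ x := fun x hx => funext (hw x hx)
  have hmonic : ∀ x ∈ U, ∀ n, (P n x).Monic := fun x hx n => hPmonic n x hx
  have hdeg : ∀ x ∈ U, ∀ n, (P n x).natDegree = n := fun x hx n => hPdeg n x hx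
  have horth' : ∀ x ∈ U, ∀ m n, m ≠ n → momentFunctional hγ x (P m x * P n x) = 0 := by
    intro x hx m n hmn
    simpa [momentFunctional_apply, hw' x hx] using horth m n hmn x hx
  have hh' : ∀ n, ∀ x ∈ U, momentFunctional hγ x (P n x * P n x) = h n x := by
    intro n x hx
    simp [momentFunctional_apply, hh n x hx, hw' x hx, sq]
  have hhne : ∀ n, ∀ x ∈ U, h n x ≠ 0 := fun n x hx => (hhpos n x hx).ne'
  have hR' : ∀ n j, ∀ x ∈ U, γ j * poleFunctional hγ x j (P n x * P n x) = R n j x * h n x := by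
    intro n j x hx
    have := hhne n x hx
    rw [hR n j x hx, hw' x hx, poleFunctional_apply]
    simp only [eval_mul, sq]
    field_simp
  have hr' : ∀ n j, ∀ x ∈ U,
      γ j * poleFunctional hγ x j (P (n + 1) x * P n x) = r (n + 1) j x * h n x := by
    intro n j x hx
    have := hhne n x hx
    rw [hr n j x hx, hw' x hx, poleFunctional_apply]
    simp only [eval_mul]
    field_simp
  have hdiff : ∀ n k, ∀ x ∈ U, DifferentiableAt ℝ (fun x => (P n x).coeff k) x := fun n k x hx =>
    ((hPC2 n k).contDiffAt (hU.mem_nhds hx)).differentiableAt (by norm_num)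
  have hderiv_h : ∀ n j, ∀ x ∈ U,
      HasDerivAt (fun s => h n (Function.update x j s)) (-(R n j x * h n x)) (x j) := by
    intro n j x hx
    have := hasDerivAt_momentFunctional_sq hγ hU hPmonic hPdeg horth' hdiff hx n j
    rw [hR' n j x hx] at this
    exact this.congr_of_eventuallyEq
      ((eventually_update_mem hU hx j).mono fun s hs => (hh' n _ hs).symm)
  have hsum_R : ∀ n, ∀ x ∈ U, ∑ j, R n j x = 2 * ((X * P n x).coeff n - (P (n + 1) x).coeff n) := by
    intro n x hx
    have h1 := momentFunctional_derivative (t := x) hγ (P n x * P n x)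
    rw [map_derivative_sq (hmonic x hx) (hdeg x hx) (horth' x hx),
      map_X_mul_sq (hmonic x hx) (hdeg x hx) (horth' x hx), hh' n x hx,
      Finset.sum_congr rfl fun j _ => hR' n j x hx, ← Finset.sum_mul] at h1
    refine mul_right_cancel₀ (hhne n x hx) ?_
    linarith
  have hpd_log : ∀ n j, ∀ x ∈ U,
      pd j (fun y => Real.log (∏ i ∈ Finset.range n, h i y)) x = -∑ i ∈ Finset.range n, R i j x := by
    intro n j x hx
    rw [pd_congr hU hx (g := fun y => ∑ i ∈ Finset.range n, Real.log (h i y))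
      (fun z hz => Real.log_prod fun i _ => hhne i z hz), ← Finset.sum_neg_distrib]
    refine (HasDerivAt.fun_sum fun i _ => ((hderiv_h i j x hx).log ?_).congr_deriv ?_).deriv
    · rw [Function.update_eq_self]; exact hhne i x hx
    · rw [Function.update_eq_self, neg_div, mul_div_cancel_right₀ _ (hhne i x hx)]
  obtain ⟨n, rfl⟩ := Nat.exists_eq_add_of_le' hn
  have hσ' : ∀ x ∈ U, σ (n + 1) x = 2 * (P (n + 1) x).coeff n := by
    intro x hx
    rw [hσ _ x hx, Finset.sum_congr rfl fun j _ => hpd_log (n + 1) j x hx, Finset.sum_neg_distrib,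
      Finset.sum_comm, Finset.sum_congr rfl fun i _ => hsum_R i x hx, ← Finset.mul_sum,
      sum_coeff_sub_coeff]
    ring
  have hσC2 : ContDiffOn ℝ 2 (σ (n + 1)) U :=
    (contDiffOn_const.mul (hPC2 (n + 1) n)).congr hσ'
  have hpd_σ : ∀ j, ∀ x ∈ U, pd j (σ (n + 1)) x = 2 * r (n + 1) j x := by
    intro j x hx
    have hne := hhne n x hx
    rw [pd_congr hU hx hσ']
    refine ((hasDerivAt_coeff_update hγ hU hPmonic hPdeg horth' hdiff hx n
      (by rwa [hh' n x hx]) j).const_mul 2).deriv.trans ?_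
    rw [hh' n x hx, div_mul_eq_mul_div, hr' n j x hx, mul_div_cancel_right₀ _ hne]
  have hsum_σ : ∀ x ∈ U, ∑ k, pd k (σ (n + 1)) x = 4 * (h (n + 1) x / h n x) - 2 * (n + 1) := by
    intro x hx
    have hne := hhne n x hx
    have h1 := momentFunctional_derivative (t := x) hγ (P (n + 1) x * P n x)
    rw [map_derivative_mul (hmonic x hx) (hdeg x hx) (horth' x hx),
      map_X_mul_mul (hmonic x hx) (hdeg x hx) (horth' x hx), hh' n x hx, hh' (n + 1) x hx,
      Finset.sum_congr rfl fun j _ => hr' n j x hx, ← Finset.sum_mul] at h1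
    rw [Finset.sum_congr rfl fun j _ => hpd_σ j x hx, ← Finset.mul_sum]
    field_simp
    linarith
  have hpd_pd_σ : ∀ j, pd j (pd j (σ (n + 1))) x + ∑ k ∈ Finset.univ.erase j, pd k (pd j (σ (n + 1))) x
      = 4 * (h (n + 1) x / h n x) * (R n j x - R (n + 1) j x) := by
    intro j
    have hne := hhne n x hx
    rw [Finset.add_sum_erase _ (fun k => pd k (pd j (σ (n + 1))) x) (Finset.mem_univ j),
      sum_pd_pd hU hx hσC2, pd_congr hU hx hsum_σ]
    refine ((((hderiv_h (n + 1) j x hx).div (hderiv_h n j x hx) ?_).const_mul 4).sub_const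
      _).deriv.trans ?_
    · rwa [Function.update_eq_self]
    · rw [Function.update_eq_self]
      field_simp
      ring
  have hrr : ∀ j, r (n + 1) j x * (r (n + 1) j x - γ j) =
      h (n + 1) x / h n x * (R (n + 1) j x * R n j x) := by
    intro j
    have hne := hhne n x hx
    have h1 := pole_mul_pole_sub (hmonic x hx) (hdeg x hx) (horth' x hx)
      (poleFunctional_X_sub_C_mul hγ j) n
    have h2 := hr' n j x hx
    have h3 := hR' n j x hx
    have h4 := hR' (n + 1) j x hx
    rw [hh' n x hx] at h1
    field_simp
    refine mul_right_cancel₀ hne ?_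
    linear_combination γ j ^ 2 * h1 - (r (n + 1) j x * h n x + γ j * poleFunctional hγ x j
      (P (n + 1) x * P n x) - γ j * h n x) * h2 + R (n + 1) j x * h (n + 1) x * h3
      + γ j * poleFunctional hγ x j (P n x * P n x) * h4
  have hΔ : ∀ j, (pd j (pd j (σ (n + 1))) x
        + ∑ k ∈ Finset.univ.erase j, pd k (pd j (σ (n + 1))) x) ^ 2
      + 4 * (2 * ((n + 1 : ℕ) : ℝ) + ∑ k, pd k (σ (n + 1)) x) * pd j (σ (n + 1)) x
        * (pd j (σ (n + 1)) x - 2 * γ j)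
      = (4 * (h (n + 1) x / h n x) * (R (n + 1) j x + R n j x)) ^ 2 := by
    intro j
    rw [hpd_pd_σ, hsum_σ x hx, hpd_σ j x hx]
    push_cast
    linear_combination 64 * (h (n + 1) x / h n x) * hrr j
  refine ⟨fun j => by rw [hΔ]; positivity, ?_⟩
  have hc : 0 ≤ 4 * (h (n + 1) x / h n x) :=
    mul_nonneg (by norm_num) (div_nonneg (hhpos _ x hx).le (hhpos _ x hx).le)
  simp only [hΔ, Nat.add_sub_cancel, sign_mul_sqrt_sq _ _ hc]
  rw [← Finset.mul_sum, Finset.sum_add_distrib, hsum_R _ x hx, hsum_R _ x hx, hσ' x hx,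
    Finset.sum_congr rfl fun j _ => by rw [hpd_σ j x hx]]
  have hne := hhne n x hx
  have hK : ∀ j, γ j * poleFunctional hγ x j (X * (P (n + 1) x * P n x)) =
      x j * r (n + 1) j x * h n x := by
    intro j
    have h1 := poleFunctional_X_sub_C_mul (t := x) hγ j (P (n + 1) x * P n x)
    rw [horth' x hx _ _ n.succ_ne_self, sub_mul, map_sub, ← smul_eq_C_mul, map_smul,
      smul_eq_mul] at h1
    linear_combination γ j * h1 + x j * hr' n j x hx
  have h1 := momentFunctional_derivative (t := x) hγ (X * (P (n + 1) x * P n x))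
  rw [map_derivative_X_mul_mul (hmonic x hx) (hdeg x hx) (horth' x hx),
    map_X_mul_X_mul_mul (hmonic x hx) (hdeg x hx) (horth' x hx), hh' n x hx, hh' (n + 1) x hx,
    Finset.sum_congr rfl fun j _ => hK j, ← Finset.sum_mul] at h1
  have h2 : ∑ j, x j * (2 * r (n + 1) j x) = 2 * ∑ j, x j * r (n + 1) j x := by
    rw [Finset.mul_sum]
    exact Finset.sum_congr rfl fun j _ => by ring
  rw [h2, coeff_X_mul]
  field_simp
  linarith
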